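/- arXiv:1502.01870 — 5 statements merged into one kernel-verified Lean document; each statement's English description precedes it below -/
import Mathlib

section
/- Let K be a real 2n×2n matrix and α a real symmetric 2n×2n matrix such that the pair (K,α) satisfies the positivity condition. Then α is positive semidefinite. -/
open Matrix Complex
open scoped ComplexOrder

/-- The standard symplectic form on `2*n` modes: block-diagonal with
`n` copies of `[[0,1],[-1,0]]`. -/
noncomputable def SympForm (n : ℕ) : Matrix (Fin (2*n)) (Fin (2*n)) ℝ :=
  Matrix.of fun i j =>
    if (i : ℕ) + 1 = (j : ℕ) ∧ (i : ℕ) % 2 = 0 then 1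
    else if (j : ℕ) + 1 = (i : ℕ) ∧ (j : ℕ) % 2 = 0 then -1 else 0

/-- Total transposition: block-diagonal with `n` copies of `diag(1,-1)`. -/
noncomputable def Transp (n : ℕ) : Matrix (Fin (2*n)) (Fin (2*n)) ℝ :=
  Matrix.diagonal fun i => if (i : ℕ) % 2 = 0 then 1 else -1

/-- `σ ≥ ± iΔ` : both `σ + iΔ` and `σ - iΔ` (as complex matrices) are PSD. -/
noncomputable def GeqPMiDelta {n : ℕ} (σ : Matrix (Fin (2*n)) (Fin (2*n)) ℝ) : Prop :=
  (σ.map (Complex.ofReal) + Complex.I • (SympForm n).map (Complex.ofReal)).PosSemidef ∧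
  (σ.map (Complex.ofReal) - Complex.I • (SympForm n).map (Complex.ofReal)).PosSemidef

/-- A quantum covariance matrix: real symmetric with `σ ≥ ± iΔ`. -/
noncomputable def IsQCM {n : ℕ} (σ : Matrix (Fin (2*n)) (Fin (2*n)) ℝ) : Prop :=
  σ.IsSymm ∧ GeqPMiDelta σ

/-- The positivity condition: `K σ Kᵀ + α ≥ ± iΔ` for every quantum covariance matrix `σ`. -/
noncomputable def PosCond {n : ℕ} (K α : Matrix (Fin (2*n)) (Fin (2*n)) ℝ) : Prop :=
  ∀ σ : Matrix (Fin (2*n)) (Fin (2*n)) ℝ, IsQCM σ → GeqPMiDelta (K * σ * Kᵀ + α)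

lemma sympForm_transpose (n : ℕ) : (SympForm n)ᵀ = -SympForm n := by
  ext i j
  simp only [SympForm, transpose_apply, of_apply, Matrix.neg_apply]
  split_ifs <;> first | omega | norm_num

lemma sympForm_mul_self (n : ℕ) : SympForm n * SympForm n = -1 := by
  ext i j
  have hp : (if (i : ℕ) % 2 = 0 then (i : ℕ) + 1 else (i : ℕ) - 1) < 2 * n := by
    split_ifs <;> omega
  rw [mul_apply, Finset.sum_eq_single ⟨_, hp⟩]
  · rw [Matrix.neg_apply, one_apply]
    simp only [SympForm, of_apply, Fin.ext_iff]
    split_ifs <;> first | omega | norm_num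
  · intro k _ hk
    have hk' : (k : ℕ) ≠ if (i : ℕ) % 2 = 0 then (i : ℕ) + 1 else (i : ℕ) - 1 :=
      fun h => hk (Fin.ext h)
    have : SympForm n i k = 0 := by
      simp only [SympForm, of_apply]
      split_ifs at hk' ⊢ <;> first | omega | rfl
    rw [this, zero_mul]
  · simp

/-- If `P` is a Hermitian projection and `H` a Hermitian involution with `P * H * P = 0`, then
weighting the range of `P` by `ε` and its complement by `1 + ε⁻¹` dominates `-H`. -/
lemma posSemidef_weighted_projection_add {m : Type*} [Fintype m] [DecidableEq m]
    {P H : Matrix m m ℂ} (hP : Pᴴ = P) (hPP : P * P = P) (hH : Hᴴ = H) (hHH : H * H = 1)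
    (hPHP : P * H * P = 0) {ε : ℝ} (hε : 0 < ε) :
    (ε • P + (1 + ε⁻¹) • (1 - P) + H).PosSemidef := by
  have hQH : (1 - P)ᴴ = 1 - P := by simp [hP]
  have e1 := (posSemidef_conjTranspose_mul_self (ε • P + P * H * (1 - P))).smul
    (inv_nonneg.2 hε.le)
  have e2 := (posSemidef_conjTranspose_mul_self ((1 + H) * (1 - P))).smul
    (by norm_num : (0 : ℝ) ≤ 2⁻¹)
  have e3 := (posSemidef_conjTranspose_mul_self ((1 - P) * H * (1 - P))).smul
    (inv_nonneg.2 hε.le)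
  convert (e1.add e2).add e3 using 1
  simp only [conjTranspose_mul, conjTranspose_add, conjTranspose_smul, hP, hH, hQH,
    conjTranspose_one, star_trivial]
  have hPHP' : P * (H * P) = 0 := by rw [← mul_assoc, hPHP]
  have a1 (X : Matrix m m ℂ) : P * (P * X) = P * X := by rw [← mul_assoc, hPP]
  have a2 (X : Matrix m m ℂ) : H * (H * X) = X := by rw [← mul_assoc, hHH, one_mul]
  have a3 (X : Matrix m m ℂ) : P * (H * (P * X)) = 0 := by
    rw [← mul_assoc, ← mul_assoc, hPHP, zero_mul]
  simp only [mul_add, add_mul, mul_sub, sub_mul, mul_one, one_mul, smul_mul_assoc,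
    mul_smul_comm, mul_assoc, hPP, hHH, hPHP', a1, a2, a3, smul_add, smul_sub, smul_smul,
    mul_zero, sub_zero, inv_mul_cancel₀ hε.ne', inv_mul_cancel_left₀ hε.ne']
  module

/-- Any direction can be squeezed to arbitrarily small variance. -/
lemma exists_isQCM_dotProduct_mulVec_eq {n : ℕ} (v : Fin (2 * n) → ℝ) {ε : ℝ} (hε : 0 < ε) :
    ∃ σ : Matrix (Fin (2 * n)) (Fin (2 * n)) ℝ, IsQCM σ ∧ v ⬝ᵥ σ *ᵥ v = ε * (v ⬝ᵥ v) := by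
  set P : Matrix (Fin (2 * n)) (Fin (2 * n)) ℝ := (v ⬝ᵥ v)⁻¹ • vecMulVec v v with hPdef
  have hPv : P *ᵥ v = v := by
    rcases eq_or_ne v 0 with rfl | hv
    · simp
    · have : v ⬝ᵥ v ≠ 0 := by simpa using hv
      simp [hPdef, smul_mulVec, vecMulVec_mulVec, smul_smul, this]
  have hPT : Pᵀ = P := by simp [hPdef, transpose_smul, transpose_vecMulVec]
  have hPP : P * P = P := by
    conv_lhs => rw [hPdef, mul_smul_comm, mul_vecMulVec, hPv]
  have hJv : v ⬝ᵥ SympForm n *ᵥ v = 0 := by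
    have h1 : v ⬝ᵥ SympForm n *ᵥ v = v ⬝ᵥ (SympForm n)ᵀ *ᵥ v := by
      rw [mulVec_transpose, dotProduct_mulVec, dotProduct_comm]
    rw [sympForm_transpose, neg_mulVec, dotProduct_neg] at h1
    linarith
  have hPJP : P * SympForm n * P = 0 := by
    rw [hPdef, smul_mul_assoc, smul_mul_assoc, mul_smul_comm, vecMulVec_mul,
      vecMulVec_mul_vecMulVec, ← dotProduct_mulVec, hJv]
    simp
  let c := Complex.ofRealHom.mapMatrix (m := Fin (2 * n))
  have hc (A : Matrix (Fin (2 * n)) (Fin (2 * n)) ℝ) : A.map Complex.ofReal = c A := rfl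
  have hcT (A : Matrix (Fin (2 * n)) (Fin (2 * n)) ℝ) : (c A)ᴴ = c Aᵀ := by
    ext i j
    simp [c]
  have hcs (r : ℝ) (A : Matrix (Fin (2 * n)) (Fin (2 * n)) ℝ) : c (r • A) = r • c A := by
    ext i j
    simp [c]
  have hH : (Complex.I • c (SympForm n))ᴴ = Complex.I • c (SympForm n) := by
    rw [conjTranspose_smul, hcT, sympForm_transpose, map_neg]
    simp
  have hHH : (Complex.I • c (SympForm n)) * (Complex.I • c (SympForm n)) = 1 := by
    rw [smul_mul_smul_comm, ← map_mul, sympForm_mul_self]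
    simp
  have hPHP : c P * (Complex.I • c (SympForm n)) * c P = 0 := by
    rw [mul_smul_comm, smul_mul_assoc, ← map_mul, ← map_mul, hPJP]
    simp
  have hcP : (c P)ᴴ = c P := by rw [hcT, hPT]
  have hcPP : c P * c P = c P := by rw [← map_mul, hPP]
  refine ⟨ε • P + (1 + ε⁻¹) • (1 - P), ⟨?_, ?_, ?_⟩, ?_⟩
  · simp [IsSymm, hPT]
  · simp only [hc, map_add, map_sub, map_one, hcs]
    exact posSemidef_weighted_projection_add hcP hcPP hH hHH hPHP hε
  · simp only [hc, map_add, map_sub, map_one, hcs]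
    rw [sub_eq_add_neg]
    exact posSemidef_weighted_projection_add hcP hcPP (by rw [conjTranspose_neg, hH])
      (by rw [neg_mul_neg, hHH]) (by rw [mul_neg, neg_mul, hPHP, neg_zero]) hε
  · simp [add_mulVec, sub_mulVec, smul_mulVec, hPv]

lemma GeqPMiDelta.dotProduct_mulVec_nonneg {n : ℕ} {σ : Matrix (Fin (2 * n)) (Fin (2 * n)) ℝ}
    (h : GeqPMiDelta σ) (w : Fin (2 * n) → ℝ) : 0 ≤ w ⬝ᵥ σ *ᵥ w := by
  have h1 := (h.1.add h.2).dotProduct_mulVec_nonneg (fun i => (w i : ℂ))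
  rw [add_add_sub_cancel, add_mulVec, dotProduct_add] at h1
  have h2 : star (fun i => (w i : ℂ)) ⬝ᵥ σ.map Complex.ofReal *ᵥ (fun i => (w i : ℂ)) =
      ((w ⬝ᵥ σ *ᵥ w : ℝ) : ℂ) := by
    simp [dotProduct, mulVec]
  rw [h2] at h1
  norm_cast at h1
  linarith

/-- If the pair `(K, α)` (with `α` real symmetric) satisfies the positivity condition,
then `α` is positive semidefinite. -/
theorem stmt1 (n : ℕ) (hn : 0 < n) (K α : Matrix (Fin (2*n)) (Fin (2*n)) ℝ)
    (hα : α.IsSymm) (h : PosCond K α) : α.PosSemidef := by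
  refine PosSemidef.of_dotProduct_mulVec_nonneg (by simpa [IsHermitian] using hα.eq) fun w => ?_
  rw [star_trivial]
  set v := Kᵀ *ᵥ w with hv
  refine le_of_forall_pos_le_add fun δ hδ => ?_
  have hvv : 0 ≤ v ⬝ᵥ v := by simpa using dotProduct_star_self_nonneg v
  obtain ⟨σ, hσ, hσv⟩ := exists_isQCM_dotProduct_mulVec_eq v (ε := δ / (v ⬝ᵥ v + 1))
    (by positivity)
  have h1 := (h σ hσ).dotProduct_mulVec_nonneg w
  have h2 : w ⬝ᵥ (K * σ * Kᵀ) *ᵥ w = v ⬝ᵥ σ *ᵥ v := by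
    rw [← mulVec_mulVec, ← mulVec_mulVec, ← hv, dotProduct_mulVec, ← mulVec_transpose]
  rw [add_mulVec, dotProduct_add, h2, hσv] at h1
  have h3 : δ / (v ⬝ᵥ v + 1) * (v ⬝ᵥ v) ≤ δ := by
    rw [div_mul_eq_mul_div, div_le_iff₀ (by positivity)]
    nlinarith
  linarith
end

section
/- Let μ be a nonzero real number, K a real 2n×2n matrix, and α a real symmetric 2n×2n matrix. Then the following are equivalent: (i) K σ Kᵀ + α ≥ ±iΔ holds for every real symmetric 2n×2n matrix σ with σ ≥ ±i μ² Δ (i.e. for every σ whose symplectic eigenvalues are all at least μ²); (ii) the pair (μK, α) satisfies the positivity condition. -/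
open Matrix Complex
open scoped ComplexOrder

/-- `σ ≥ ± i c Δ` : both `σ + icΔ` and `σ - icΔ` (as complex matrices) are PSD. -/
noncomputable def GeqPMicDelta {n : ℕ} (c : ℝ) (σ : Matrix (Fin (2*n)) (Fin (2*n)) ℝ) : Prop :=
  (σ.map (Complex.ofReal) + ((c : ℂ) * Complex.I) • (SympForm n).map (Complex.ofReal)).PosSemidef ∧
  (σ.map (Complex.ofReal) - ((c : ℂ) * Complex.I) • (SympForm n).map (Complex.ofReal)).PosSemidef

/-- For `c > 0`, `c • σ ≥ ± i c Δ` is the same as `σ ≥ ± i Δ`. -/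
theorem geqPMicDelta_smul_iff {n : ℕ} {c : ℝ} (hc : 0 < c)
    (σ : Matrix (Fin (2*n)) (Fin (2*n)) ℝ) :
    GeqPMicDelta c (c • σ) ↔ GeqPMiDelta σ := by
  have hc' : (0 : ℂ) < (c : ℂ) := by exact_mod_cast hc
  have hmap : (c • σ).map Complex.ofReal = (c : ℂ) • σ.map Complex.ofReal := by
    ext i j
    simp
  have smul_iff (M : Matrix (Fin (2*n)) (Fin (2*n)) ℂ) :
      ((c : ℂ) • M).PosSemidef ↔ M.PosSemidef := by
    refine ⟨fun h => ?_, fun h => h.smul hc'.le⟩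
    have h' := h.smul (a := (c : ℂ)⁻¹) (by exact_mod_cast (inv_pos.mpr hc).le)
    rwa [inv_smul_smul₀ hc'.ne'] at h'
  unfold GeqPMicDelta GeqPMiDelta
  rw [hmap, mul_smul, ← smul_add, ← smul_sub, smul_iff, smul_iff]

/-- `K σ Kᵀ + α ≥ ± iΔ` holds for every real symmetric `σ ≥ ± i μ² Δ` iff the pair
`(μK, α)` satisfies the positivity condition. -/
theorem stmt11 (n : ℕ) (hn : 0 < n) (μ : ℝ) (hμ : μ ≠ 0)
    (K α : Matrix (Fin (2*n)) (Fin (2*n)) ℝ) (hα : α.IsSymm) :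
    (∀ σ : Matrix (Fin (2*n)) (Fin (2*n)) ℝ, σ.IsSymm → GeqPMicDelta (μ^2) σ →
        GeqPMiDelta (K * σ * Kᵀ + α)) ↔
      PosCond (μ • K) α := by
  have hμ2 : 0 < μ ^ 2 := by positivity
  have hconj (σ : Matrix (Fin (2*n)) (Fin (2*n)) ℝ) :
      μ • K * σ * (μ • K)ᵀ = K * (μ ^ 2 • σ) * Kᵀ := by
    simp [Matrix.transpose_smul, smul_smul, sq]
  constructor
  · rintro h σ ⟨hsymm, hσ⟩
    rw [hconj]
    exact h _ (hsymm.smul _) ((geqPMicDelta_smul_iff hμ2 σ).2 hσ)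
  · intro h σ hsymm hσ
    have hσ' : μ ^ 2 • ((μ ^ 2)⁻¹ • σ) = σ := smul_inv_smul₀ hμ2.ne' σ
    rw [← hσ', geqPMicDelta_smul_iff hμ2] at hσ
    have := h _ ⟨hsymm.smul _, hσ⟩
    rwa [hconj, hσ'] at this
end

section
/- Let K be a real 2n×2n matrix such that the pair (K, 0) satisfies the positivity condition, i.e. K σ Kᵀ ≥ ±iΔ for every quantum covariance matrix σ. Then there exist a real number κ ≥ 1 and a symplectic matrix S such that either K = κ·S or K = κ·S·T. (Every noiseless Gaussian-to-Gaussian map is a dilatation, possibly composed with the total transposition, followed by a symplectic transformation.) -/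
open Matrix Complex
open scoped ComplexOrder

/-- The mode partner of an index: `2k ↔ 2k+1`. -/
def modePartner {n : ℕ} (i : Fin (2*n)) : Fin (2*n) :=
  if h : (i : ℕ) % 2 = 0 then ⟨i + 1, by omega⟩ else ⟨i - 1, by omega⟩

lemma coe_modePartner {n : ℕ} (i : Fin (2*n)) :
    (modePartner i : ℕ) = if (i : ℕ) % 2 = 0 then (i : ℕ) + 1 else (i : ℕ) - 1 := by
  unfold modePartner
  split_ifs <;> rfl

lemma modePartner_even_iff {n : ℕ} (i : Fin (2*n)) :
    (modePartner i : ℕ) % 2 = 0 ↔ ¬ (i : ℕ) % 2 = 0 := by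
  rw [coe_modePartner]
  split_ifs <;> omega

lemma modePartner_modePartner {n : ℕ} (i : Fin (2*n)) : modePartner (modePartner i) = i := by
  rw [Fin.ext_iff, coe_modePartner, coe_modePartner]
  split_ifs <;> omega

lemma sympForm_apply {n : ℕ} (i j : Fin (2*n)) :
    SympForm n i j = if modePartner i = j then (if (i : ℕ) % 2 = 0 then 1 else -1) else 0 := by
  simp only [SympForm, Matrix.of_apply, modePartner]
  split_ifs <;> simp_all [Fin.ext_iff] <;> omega

lemma transp_mul_self (n : ℕ) : Transp n * Transp n = 1 := by
  rw [Transp, Matrix.diagonal_mul_diagonal, ← Matrix.diagonal_one]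
  congr 1
  ext i
  split_ifs <;> simp

lemma transp_transpose (n : ℕ) : (Transp n)ᵀ = Transp n :=
  Matrix.diagonal_transpose _

lemma transp_mul_sympForm_mul_transp (n : ℕ) :
    Transp n * SympForm n * Transp n = -SympForm n := by
  ext i j
  simp only [Transp, Matrix.mul_diagonal, Matrix.diagonal_mul, SympForm, Matrix.of_apply,
    Matrix.neg_apply]
  split_ifs <;> first | (exfalso; omega) | simp

lemma posSemidef_of_mul_self_eq_two_smul {m : Type*} [Fintype m] [DecidableEq m]
    {A : Matrix m m ℂ} (hA : Aᴴ = A) (hA2 : A * A = (2 : ℂ) • A) : A.PosSemidef := by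
  have h := (Matrix.posSemidef_conjTranspose_mul_self A).smul (a := (1/2 : ℝ)) (by norm_num)
  rw [hA, hA2] at h
  convert h using 1
  ext i j
  simp

lemma geqPMiDelta_one (n : ℕ) : GeqPMiDelta (1 : Matrix (Fin (2*n)) (Fin (2*n)) ℝ) := by
  set D : Matrix (Fin (2*n)) (Fin (2*n)) ℂ := (SympForm n).map Complex.ofReal with hD
  have hT : Dᴴ = -D := by
    ext i j
    have := congrFun (congrFun (sympForm_transpose n) i) j
    simp only [Matrix.transpose_apply, Matrix.neg_apply] at this
    simp [hD, this]
  have hsq : D * D = -1 := by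
    have h2 : (SympForm n * SympForm n).map Complex.ofRealHom = D * D := Matrix.map_mul
    rw [← h2, sympForm_mul_self]
    ext i j
    simp [Matrix.one_apply, apply_ite]
  have h1 : (1 : Matrix (Fin (2*n)) (Fin (2*n)) ℝ).map Complex.ofReal = 1 := by
    ext i j
    simp [Matrix.one_apply, apply_ite]
  have hI : (Complex.I • D) * (Complex.I • D) = 1 := by
    simp [hsq, smul_smul]
  unfold GeqPMiDelta
  rw [h1, ← hD]
  constructor <;> apply posSemidef_of_mul_self_eq_two_smul
  · simp [hT]
  · rw [add_mul, mul_add, mul_add, hI, two_smul]; simp; abel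
  · simp [hT]
  · rw [sub_mul, mul_sub, mul_sub, hI, two_smul]; simp; abel

lemma GeqPMiDelta.conj {n : ℕ} {σ S : Matrix (Fin (2*n)) (Fin (2*n)) ℝ} (hσ : GeqPMiDelta σ)
    (hS : S * SympForm n * Sᵀ = SympForm n ∨ S * SympForm n * Sᵀ = -SympForm n) :
    GeqPMiDelta (S * σ * Sᵀ) := by
  have hmap (M : Matrix (Fin (2*n)) (Fin (2*n)) ℝ) : (S * M * Sᵀ).map Complex.ofReal =
      S.map Complex.ofReal * M.map Complex.ofReal * (S.map Complex.ofReal)ᴴ := by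
    have h2 : (S.map Complex.ofReal)ᴴ = Sᵀ.map Complex.ofReal := by
      ext i j; simp
    rw [h2]
    change (S * M * Sᵀ).map Complex.ofRealHom = _
    rw [Matrix.map_mul, Matrix.map_mul]
    rfl
  obtain ⟨hp, hm⟩ := hσ
  have hp' := hp.mul_mul_conjTranspose_same (S.map Complex.ofReal)
  have hm' := hm.mul_mul_conjTranspose_same (S.map Complex.ofReal)
  rw [mul_add, add_mul, mul_smul_comm, smul_mul_assoc, ← hmap, ← hmap] at hp'
  rw [mul_sub, sub_mul, mul_smul_comm, smul_mul_assoc, ← hmap, ← hmap] at hm'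
  have hneg : (-SympForm n).map Complex.ofReal = -(SympForm n).map Complex.ofReal := by
    ext i j; simp
  rcases hS with hS | hS
  · rw [hS] at hp' hm'
    exact ⟨hp', hm'⟩
  · rw [hS, hneg, smul_neg] at hp' hm'
    exact ⟨by simpa using hm', by simpa [← sub_eq_add_neg] using hp'⟩

lemma isQCM_mul_transpose {n : ℕ} {S : Matrix (Fin (2*n)) (Fin (2*n)) ℝ}
    (hS : S * SympForm n * Sᵀ = SympForm n ∨ S * SympForm n * Sᵀ = -SympForm n) :
    IsQCM (S * Sᵀ) := by
  refine ⟨Matrix.isSymm_mul_transpose_self S, ?_⟩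
  simpa using (geqPMiDelta_one n).conj hS

/-- The real form of the uncertainty relation. -/
lemma GeqPMiDelta.two_mul_le {n : ℕ} {σ : Matrix (Fin (2*n)) (Fin (2*n)) ℝ}
    (hσ : GeqPMiDelta σ) (x y : Fin (2*n) → ℝ) :
    2 * (x ⬝ᵥ SympForm n *ᵥ y) ≤ x ⬝ᵥ σ *ᵥ x + y ⬝ᵥ σ *ᵥ y := by
  have hT : y ⬝ᵥ SympForm n *ᵥ x = -(x ⬝ᵥ SympForm n *ᵥ y) := by
    rw [Matrix.dotProduct_mulVec, ← Matrix.mulVec_transpose, sympForm_transpose,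
      Matrix.neg_mulVec, neg_dotProduct, dotProduct_comm]
  have key := (Complex.le_def.mp
    (hσ.1.dotProduct_mulVec_nonneg (fun i => (x i : ℂ) + Complex.I * y i))).1
  have e : (star (fun i => (x i : ℂ) + Complex.I * y i) ⬝ᵥ
      (σ.map Complex.ofReal + Complex.I • (SympForm n).map Complex.ofReal) *ᵥ
        (fun i => (x i : ℂ) + Complex.I * y i)).re =
      x ⬝ᵥ σ *ᵥ x + y ⬝ᵥ σ *ᵥ y - x ⬝ᵥ SympForm n *ᵥ y + y ⬝ᵥ SympForm n *ᵥ x := by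
    simp only [dotProduct, Matrix.mulVec, Finset.mul_sum, ← Finset.sum_add_distrib,
      ← Finset.sum_sub_distrib, Complex.re_sum]
    refine Finset.sum_congr rfl fun i _ => Finset.sum_congr rfl fun j _ => ?_
    simp
    ring
  rw [e, hT] at key
  simp only [Complex.zero_re] at key
  linarith

/-- The squeezing along `u`: it scales `u` by `t` and `Δ u` by `t⁻¹`. -/
noncomputable def squeeze {n : ℕ} (u : Fin (2*n) → ℝ) (t : ℝ) : Matrix (Fin (2*n)) (Fin (2*n)) ℝ :=
  1 + ((t - 1) / (u ⬝ᵥ u)) • Matrix.vecMulVec u u +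
    ((t⁻¹ - 1) / (u ⬝ᵥ u)) • Matrix.vecMulVec (SympForm n *ᵥ u) (SympForm n *ᵥ u)

lemma squeeze_transpose {n : ℕ} (u : Fin (2*n) → ℝ) (t : ℝ) :
    (squeeze u t)ᵀ = squeeze u t := by
  simp [squeeze, Matrix.transpose_vecMulVec]

lemma dotProduct_sympForm_self {n : ℕ} (u : Fin (2*n) → ℝ) : u ⬝ᵥ SympForm n *ᵥ u = 0 := by
  have h : u ⬝ᵥ SympForm n *ᵥ u = -(u ⬝ᵥ SympForm n *ᵥ u) := by
    nth_rewrite 1 [Matrix.dotProduct_mulVec, ← Matrix.mulVec_transpose, sympForm_transpose,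
      Matrix.neg_mulVec, neg_dotProduct, dotProduct_comm]
    rfl
  linarith

lemma squeeze_symplectic {n : ℕ} {u : Fin (2*n) → ℝ} (hu : u ⬝ᵥ u ≠ 0) {t : ℝ} (ht : t ≠ 0) :
    squeeze u t * SympForm n * (squeeze u t)ᵀ = SympForm n := by
  rw [squeeze_transpose]
  set w := SympForm n *ᵥ u with hw
  have huΔ : u ᵥ* SympForm n = -w := by
    rw [← Matrix.mulVec_transpose, sympForm_transpose, Matrix.neg_mulVec]
  have hΔw : SympForm n *ᵥ w = -u := by
    rw [hw, Matrix.mulVec_mulVec, sympForm_mul_self, Matrix.neg_mulVec, Matrix.one_mulVec]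
  have hwΔ : w ᵥ* SympForm n = u := by
    rw [← Matrix.mulVec_transpose, sympForm_transpose, Matrix.neg_mulVec, hΔw, neg_neg]
  have huw : u ⬝ᵥ w = 0 := dotProduct_sympForm_self u
  have hwu : w ⬝ᵥ u = 0 := by rw [dotProduct_comm, huw]
  have hww : w ⬝ᵥ w = u ⬝ᵥ u := by
    nth_rewrite 2 [hw]
    rw [Matrix.dotProduct_mulVec, hwΔ]
  set r := u ⬝ᵥ u
  have hαβ : (t - 1) / r + (t⁻¹ - 1) / r + (t - 1) / r * ((t⁻¹ - 1) / r) * r = 0 := by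
    field_simp
    ring
  unfold squeeze
  rw [← hw]
  change (1 + ((t - 1) / r) • vecMulVec u u + ((t⁻¹ - 1) / r) • vecMulVec w w) * SympForm n *
    (1 + ((t - 1) / r) • vecMulVec u u + ((t⁻¹ - 1) / r) • vecMulVec w w) = _
  generalize (t - 1) / r = α at *
  generalize (t⁻¹ - 1) / r = β at *
  have e : (1 + α • vecMulVec u u + β • vecMulVec w w) * SympForm n *
      (1 + α • vecMulVec u u + β • vecMulVec w w) =
      SympForm n + (α + β + α * β * r) • (vecMulVec w u - vecMulVec u w) := by
    simp only [add_mul, mul_add, one_mul, mul_one, smul_mul_assoc, mul_smul_comm,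
      Matrix.vecMulVec_mul, Matrix.mul_vecMulVec, Matrix.vecMulVec_mulVec, huΔ, hwΔ, hΔw,
      ← hw, neg_dotProduct, huw, hwu, hww]
    ext i j
    simp [vecMulVec_apply, Matrix.neg_vecMulVec, Matrix.vecMulVec_neg]
    ring
  rw [e, hαβ, zero_smul, add_zero]

lemma squeeze_mulVec_of_orthogonal {n : ℕ} {u v : Fin (2*n) → ℝ} (t : ℝ)
    (huv : u ⬝ᵥ SympForm n *ᵥ v = 0) :
    squeeze u t *ᵥ v = v + ((t - 1) / (u ⬝ᵥ u) * (u ⬝ᵥ v)) • u := by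
  have h : (SympForm n *ᵥ u) ⬝ᵥ v = 0 := by
    rw [Matrix.dotProduct_mulVec, ← Matrix.mulVec_transpose, sympForm_transpose,
      Matrix.neg_mulVec, neg_dotProduct, neg_eq_zero] at huv
    exact huv
  simp [squeeze, Matrix.add_mulVec, Matrix.smul_mulVec, Matrix.vecMulVec_mulVec, h, smul_smul]

lemma dotProduct_conj_mulVec {m : Type*} [Fintype m] (K S : Matrix m m ℝ) (x : m → ℝ) :
    x ⬝ᵥ (K * (S * Sᵀ) * Kᵀ) *ᵥ x = (Sᵀ *ᵥ Kᵀ *ᵥ x) ⬝ᵥ (Sᵀ *ᵥ Kᵀ *ᵥ x) := by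
  simp only [Matrix.mulVec_transpose, Matrix.vecMul_vecMul]
  rw [← Matrix.dotProduct_mulVec, ← Matrix.mulVec_transpose, Matrix.mulVec_mulVec,
    Matrix.transpose_mul]
  simp only [Matrix.mul_assoc]

lemma nonpos_of_forall_mul_le {a b : ℝ} (h : ∀ s : ℝ, 1 ≤ s → s * a ≤ b) : a ≤ 0 := by
  by_contra! ha
  have h1 := h (max 1 (b / a + 1)) (le_max_left _ _)
  have h2 : (b / a + 1) * a ≤ max 1 (b / a + 1) * a :=
    mul_le_mul_of_nonneg_right (le_max_right _ _) ha.le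
  have h3 : (b / a + 1) * a = b + a := by field_simp
  linarith

lemma PosCond.two_mul_le {n : ℕ} {K S : Matrix (Fin (2*n)) (Fin (2*n)) ℝ} (h : PosCond K 0)
    (hS : S * SympForm n * Sᵀ = SympForm n ∨ S * SympForm n * Sᵀ = -SympForm n)
    (x y : Fin (2*n) → ℝ) (s : ℝ) :
    2 * (s * (x ⬝ᵥ SympForm n *ᵥ y)) ≤
      s ^ 2 * ((Sᵀ *ᵥ Kᵀ *ᵥ x) ⬝ᵥ (Sᵀ *ᵥ Kᵀ *ᵥ x)) + (Sᵀ *ᵥ Kᵀ *ᵥ y) ⬝ᵥ (Sᵀ *ᵥ Kᵀ *ᵥ y) := by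
  have := (h _ (isQCM_mul_transpose hS)).two_mul_le (s • x) y
  rw [add_zero, dotProduct_conj_mulVec, dotProduct_conj_mulVec] at this
  simp only [Matrix.mulVec_smul, smul_dotProduct, dotProduct_smul, smul_eq_mul] at this
  linarith

/-- Squeezing along `Kᵀ x` shows that `Kᵀ` reflects symplectic orthogonality. -/
lemma PosCond.nonpos_of_orthogonal {n : ℕ} {K : Matrix (Fin (2*n)) (Fin (2*n)) ℝ}
    (h : PosCond K 0) {x y : Fin (2*n) → ℝ}
    (hxy : (Kᵀ *ᵥ x) ⬝ᵥ SympForm n *ᵥ (Kᵀ *ᵥ y) = 0) : x ⬝ᵥ SympForm n *ᵥ y ≤ 0 := by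
  set u := Kᵀ *ᵥ x with hu
  set v := Kᵀ *ᵥ y with hv
  by_cases hr : u ⬝ᵥ u = 0
  · refine nonpos_of_forall_mul_le (b := v ⬝ᵥ v / 2) fun s _ => ?_
    have := h.two_mul_le (S := 1) (Or.inl (by simp)) x y s
    rw [← hu, ← hv, Matrix.transpose_one, Matrix.one_mulVec, Matrix.one_mulVec, hr] at this
    linarith
  · refine nonpos_of_forall_mul_le (b := (u ⬝ᵥ u + v ⬝ᵥ v) / 2) fun s hs => ?_
    have hs0 : s ≠ 0 := by positivity
    have := h.two_mul_le (Or.inl (squeeze_symplectic hr (inv_ne_zero hs0))) x y s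
    rw [← hu, ← hv, squeeze_transpose, squeeze_mulVec_of_orthogonal _ hxy,
      squeeze_mulVec_of_orthogonal _ (dotProduct_sympForm_self u)] at this
    have hr' : 0 < u ⬝ᵥ u :=
      lt_of_le_of_ne (Finset.sum_nonneg fun i _ => mul_self_nonneg (u i)) (Ne.symm hr)
    simp only [dotProduct_add, add_dotProduct, smul_dotProduct, dotProduct_smul,
      smul_eq_mul, dotProduct_comm v u] at this
    generalize u ⬝ᵥ u = r at *
    generalize u ⬝ᵥ v = a at *
    generalize v ⬝ᵥ v = b at *
    have e1 : s ^ 2 * (r + (s⁻¹ - 1) / r * r * r + ((s⁻¹ - 1) / r * r * r +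
        (s⁻¹ - 1) / r * r * ((s⁻¹ - 1) / r * r * r))) = r := by
      field_simp
      ring
    have e2 : b + (s⁻¹ - 1) / r * a * a + ((s⁻¹ - 1) / r * a * a +
        (s⁻¹ - 1) / r * a * ((s⁻¹ - 1) / r * a * r)) = b - (1 - s⁻¹ ^ 2) * (a ^ 2 / r) := by
      field_simp
      ring
    have e3 : 0 ≤ (1 - s⁻¹ ^ 2) * (a ^ 2 / r) := by
      have := inv_le_one_of_one_le₀ hs
      have h0 : 0 ≤ s⁻¹ := by positivity
      exact mul_nonneg (by nlinarith) (by positivity)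
    linarith

lemma PosCond.eq_zero_of_orthogonal {n : ℕ} {K : Matrix (Fin (2*n)) (Fin (2*n)) ℝ}
    (h : PosCond K 0) {x y : Fin (2*n) → ℝ}
    (hxy : x ⬝ᵥ (K * SympForm n * Kᵀ) *ᵥ y = 0) : x ⬝ᵥ SympForm n *ᵥ y = 0 := by
  have hxy' : (Kᵀ *ᵥ x) ⬝ᵥ SympForm n *ᵥ (Kᵀ *ᵥ y) = 0 := by
    rw [← hxy, Matrix.mulVec_transpose K x, ← Matrix.dotProduct_mulVec, Matrix.mulVec_mulVec,
      Matrix.mulVec_mulVec, Matrix.mul_assoc]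
  refine le_antisymm (h.nonpos_of_orthogonal hxy') ?_
  have := h.nonpos_of_orthogonal (x := x) (y := -y) (by
    rw [Matrix.mulVec_neg, Matrix.mulVec_neg, dotProduct_neg, hxy', neg_zero])
  simpa [Matrix.mulVec_neg] using this

/-- A matrix mapping every vector `z` into `zᗮᗮ` is a scalar. -/
lemma eq_smul_one_of_forall_orthogonal {m : Type*} [Fintype m] [DecidableEq m]
    (M : Matrix m m ℝ) (h : ∀ x z : m → ℝ, x ⬝ᵥ z = 0 → x ⬝ᵥ M *ᵥ z = 0) :
    ∃ c : ℝ, M = c • 1 := by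
  have hoff (i j : m) (hij : i ≠ j) : M i j = 0 := by
    simpa using h (Pi.single i 1) (Pi.single j 1) (by simp [hij])
  have hdiag (i j : m) : M i i = M j j := by
    by_cases hij : i = j
    · rw [hij]
    have := h (Pi.single i 1 + Pi.single j 1) (Pi.single i 1 - Pi.single j 1)
      (by simp [dotProduct_sub, hij, Ne.symm hij])
    simp [Matrix.mulVec_sub, dotProduct_sub, add_dotProduct, hoff i j hij,
      hoff j i (Ne.symm hij)] at this
    linarith
  rcases isEmpty_or_nonempty m with hm | ⟨⟨k⟩⟩
  · exact ⟨0, Subsingleton.elim _ _⟩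
  · refine ⟨M k k, ?_⟩
    ext i j
    by_cases hij : i = j
    · subst hij; simp [hdiag i k]
    · simp [hij, hoff i j hij]

lemma exists_smul_eq_of_forall_orthogonal {m : Type*} [Fintype m] [DecidableEq m]
    {D Y : Matrix m m ℝ} (hD : IsUnit D)
    (h : ∀ x y : m → ℝ, x ⬝ᵥ Y *ᵥ y = 0 → x ⬝ᵥ D *ᵥ y = 0) :
    ∃ c : ℝ, D = c • Y := by
  have hY : IsUnit Y := by
    rw [← Matrix.mulVec_injective_iff_isUnit]
    refine (injective_iff_map_eq_zero (Matrix.mulVecLin Y)).mpr fun y hy => ?_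
    have hDy : D *ᵥ y = 0 := by
      rw [← dotProduct_self_eq_zero]
      exact h _ _ (by rw [show Y *ᵥ y = 0 from hy, dotProduct_zero])
    exact Matrix.mulVec_injective_of_isUnit hD (by rw [hDy, Matrix.mulVec_zero])
  rw [Matrix.isUnit_iff_isUnit_det] at hY
  obtain ⟨c, hc⟩ := eq_smul_one_of_forall_orthogonal (D * Y⁻¹) fun x z hxz => by
    rw [← Matrix.mulVec_mulVec]
    refine h _ _ ?_
    rwa [Matrix.mulVec_mulVec, Matrix.mul_nonsing_inv _ hY, Matrix.one_mulVec]
  refine ⟨c, ?_⟩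
  rw [← Matrix.nonsing_inv_mul_cancel_right _ D hY, hc, smul_mul_assoc, one_mul]

lemma isUnit_sympForm (n : ℕ) : IsUnit (SympForm n) :=
  IsUnit.of_mul_eq_one (-SympForm n) (by rw [mul_neg, sympForm_mul_self, neg_neg])

lemma sympForm_ne_zero {n : ℕ} (hn : 0 < n) : SympForm n ≠ 0 := fun h0 => by
  have := congrFun (congrFun h0 ⟨0, by omega⟩) ⟨1, by omega⟩
  simp [SympForm] at this

lemma PosCond.exists_conj_sympForm_eq {n : ℕ} (hn : 0 < n)
    {K : Matrix (Fin (2*n)) (Fin (2*n)) ℝ} (h : PosCond K 0) :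
    ∃ d : ℝ, d ≠ 0 ∧ K * SympForm n * Kᵀ = d • SympForm n := by
  obtain ⟨c, hc⟩ := exists_smul_eq_of_forall_orthogonal (isUnit_sympForm n)
    (Y := K * SympForm n * Kᵀ) fun x y => h.eq_zero_of_orthogonal
  have hc0 : c ≠ 0 := fun h0 => sympForm_ne_zero hn (by rw [hc, h0, zero_smul])
  refine ⟨c⁻¹, inv_ne_zero hc0, ?_⟩
  conv_rhs => rw [hc]
  rw [smul_smul, inv_mul_cancel₀ hc0, one_smul]

lemma PosCond.one_le_abs {n : ℕ} (hn : 0 < n) {K : Matrix (Fin (2*n)) (Fin (2*n)) ℝ}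
    (h : PosCond K 0) {d : ℝ} (hd : d ≠ 0) (hK : K * SympForm n * Kᵀ = d • SympForm n) :
    1 ≤ |d| := by
  have hu : IsUnit K.det := by
    have : IsUnit (K * (SympForm n * Kᵀ)) := by
      rw [← Matrix.mul_assoc, hK]
      exact (isUnit_sympForm n).smul (Units.mk0 d hd)
    rw [Matrix.isUnit_iff_isUnit_det, Matrix.det_mul] at this
    exact isUnit_of_mul_isUnit_left this
  have hinv : K⁻¹ * SympForm n * K⁻¹ᵀ = d⁻¹ • SympForm n := by
    have hΔ : SympForm n = d⁻¹ • (K * SympForm n * Kᵀ) := by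
      rw [hK, smul_smul, inv_mul_cancel₀ hd, one_smul]
    conv_lhs => rw [hΔ]
    rw [mul_smul_comm, smul_mul_assoc, Matrix.mul_assoc K, Matrix.nonsing_inv_mul_cancel_left _ _ hu,
      Matrix.mul_assoc, ← Matrix.transpose_mul, Matrix.nonsing_inv_mul _ hu, Matrix.transpose_one,
      Matrix.mul_one]
  have hsq : √|d| * √|d| = |d| := Real.mul_self_sqrt (abs_nonneg d)
  have hS : (√|d| • K⁻¹) * SympForm n * (√|d| • K⁻¹)ᵀ = (|d| * d⁻¹) • SympForm n := by
    rw [Matrix.transpose_smul, smul_mul_assoc, smul_mul_assoc, mul_smul_comm, hinv, smul_smul,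
      smul_smul, hsq]
  have hS' : (√|d| • K⁻¹) * SympForm n * (√|d| • K⁻¹)ᵀ = SympForm n ∨
      (√|d| • K⁻¹) * SympForm n * (√|d| • K⁻¹)ᵀ = -SympForm n := by
    rw [hS]
    rcases abs_cases d with ⟨e, -⟩ | ⟨e, -⟩
    · left; rw [e, mul_inv_cancel₀ hd, one_smul]
    · right; rw [e, neg_mul, mul_inv_cancel₀ hd, neg_smul, one_smul]
  have hcancel (x : Fin (2*n) → ℝ) : (√|d| • K⁻¹)ᵀ *ᵥ Kᵀ *ᵥ x = √|d| • x := by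
    rw [Matrix.mulVec_mulVec, ← Matrix.transpose_mul, mul_smul_comm, Matrix.mul_nonsing_inv _ hu,
      Matrix.transpose_smul, Matrix.transpose_one, Matrix.smul_mulVec, Matrix.one_mulVec]
  have key := h.two_mul_le hS' (Pi.single ⟨0, by omega⟩ 1) (Pi.single ⟨1, by omega⟩ 1) 1
  rw [hcancel, hcancel] at key
  simp [SympForm, hsq] at key
  linarith

/-- Every noiseless Gaussian-to-Gaussian map is a dilatation, possibly composed with
the total transposition, followed by a symplectic transformation. -/
theorem stmt12 (n : ℕ) (hn : 0 < n) (K : Matrix (Fin (2*n)) (Fin (2*n)) ℝ)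
    (h : PosCond K 0) :
    ∃ κ : ℝ, 1 ≤ κ ∧ ∃ S : Matrix (Fin (2*n)) (Fin (2*n)) ℝ,
      S * SympForm n * Sᵀ = SympForm n ∧
      (K = κ • S ∨ K = κ • (S * Transp n)) := by
  obtain ⟨d, hd, hK⟩ := h.exists_conj_sympForm_eq hn
  have hκ : 1 ≤ √|d| := Real.one_le_sqrt.mpr (h.one_le_abs hn hd hK)
  have hκ0 : √|d| ≠ 0 := by positivity
  have hsq : √|d| * √|d| = |d| := Real.mul_self_sqrt (abs_nonneg d)
  have hS : ((√|d|)⁻¹ • K) * SympForm n * ((√|d|)⁻¹ • K)ᵀ = (d / |d|) • SympForm n := by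
    rw [Matrix.transpose_smul, smul_mul_assoc, smul_mul_assoc, mul_smul_comm, hK, smul_smul,
      smul_smul, ← mul_inv, hsq, inv_mul_eq_div]
  refine ⟨√|d|, hκ, ?_⟩
  rcases lt_or_gt_of_ne hd with hneg | hpos
  · refine ⟨((√|d|)⁻¹ • K) * Transp n, ?_, Or.inr ?_⟩
    · rw [abs_of_neg hneg] at hS ⊢
      rw [Matrix.transpose_mul, transp_transpose, ← Matrix.mul_assoc,
        Matrix.mul_assoc _ (Transp n) (SympForm n), Matrix.mul_assoc _ _ (Transp n),
        transp_mul_sympForm_mul_transp, mul_neg, neg_mul, hS, div_neg, div_self hd, neg_smul,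
        one_smul, neg_neg]
    · rw [Matrix.mul_assoc, transp_mul_self, Matrix.mul_one, smul_smul, mul_inv_cancel₀ hκ0,
        one_smul]
  · refine ⟨(√|d|)⁻¹ • K, ?_, Or.inl ?_⟩
    · rw [hS, abs_of_pos hpos, div_self hd, one_smul]
    · rw [smul_smul, mul_inv_cancel₀ hκ0, one_smul]
end

section
/- Let B be a real antisymmetric 2n×2n matrix such that |w₁ᵀ B w₂| ≥ |w₁ᵀ Δ w₂| for all vectors w₁, w₂ ∈ ℝ^{2n}. Then there exists a real number c with |c| ≥ 1 such that B = c·Δ. -/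
open Matrix Complex
open scoped ComplexOrder

theorem SympForm_mulVec_even {n : ℕ} (w : Fin (2*n) → ℝ) (i j : Fin (2*n))
    (hij : (i : ℕ) + 1 = j) (hi : (i : ℕ) % 2 = 0) : (SympForm n *ᵥ w) i = w j := by
  rw [mulVec, dotProduct, Finset.sum_eq_single j]
  · simp [SympForm, hij, hi]
  · intro k _ hk
    have h₁ : ¬ ((i : ℕ) + 1 = k) := fun h => hk (Fin.ext (by omega))
    have h₂ : ¬ ((k : ℕ) + 1 = i ∧ (k : ℕ) % 2 = 0) := by omega
    simp [SympForm, h₁, h₂]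
  · simp

theorem SympForm_mulVec_odd {n : ℕ} (w : Fin (2*n) → ℝ) (i j : Fin (2*n))
    (hij : (i : ℕ) + 1 = j) (hi : (i : ℕ) % 2 = 0) : (SympForm n *ᵥ w) j = -w i := by
  rw [mulVec, dotProduct, Finset.sum_eq_single i]
  · have h₁ : ¬ ((j : ℕ) + 1 = i ∧ (j : ℕ) % 2 = 0) := by omega
    simp only [SympForm, of_apply, if_neg h₁, if_pos (And.intro hij hi), neg_one_mul]
  · intro k _ hk
    have h₁ : ¬ ((j : ℕ) + 1 = k ∧ (j : ℕ) % 2 = 0) := by omega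
    have h₂ : ¬ ((k : ℕ) + 1 = j ∧ (k : ℕ) % 2 = 0) := fun h => hk (Fin.ext (by omega))
    simp only [SympForm, of_apply, if_neg h₁, if_neg h₂, zero_mul]
  · simp

theorem SympForm_mulVec_eq_zero {n : ℕ} {w : Fin (2*n) → ℝ} (hw : SympForm n *ᵥ w = 0) :
    w = 0 := by
  funext i
  have hi := i.isLt
  rcases Nat.mod_two_eq_zero_or_one i with h | h
  · have := SympForm_mulVec_odd w i ⟨i + 1, by omega⟩ rfl h
    simpa [hw] using this.symm
  · have := SympForm_mulVec_even w ⟨i - 1, by omega⟩ i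
      (show (i : ℕ) - 1 + 1 = i by omega) (show ((i : ℕ) - 1) % 2 = 0 by omega)
    simpa [hw] using this.symm

/-- A vector annihilated by every functional that annihilates `b` is a multiple of `b`. -/
theorem exists_eq_smul_of_forall_dotProduct_eq_zero {ι : Type*} [Fintype ι] {b d : ι → ℝ}
    (h : ∀ u, u ⬝ᵥ b = 0 → u ⬝ᵥ d = 0) : ∃ t : ℝ, d = t • b := by
  set t := (d ⬝ᵥ b) / (b ⬝ᵥ b) with ht
  refine ⟨t, ?_⟩
  have hb : (d - t • b) ⬝ᵥ b = 0 := by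
    rcases eq_or_ne b 0 with rfl | hb
    · simp
    · have := mt dotProduct_self_eq_zero.1 hb
      rw [sub_dotProduct, smul_dotProduct, smul_eq_mul, ht, div_mul_cancel₀ _ this, sub_self]
  rw [← sub_eq_zero, ← dotProduct_self_eq_zero, dotProduct_sub, dotProduct_smul, hb, h _ hb,
    smul_zero, sub_zero]

/-- If `D *ᵥ w` is a multiple of `B *ᵥ w` for every `w` and `B` is invertible, then `D` is a
multiple of `B`. -/
theorem exists_eq_smul_of_forall_mulVec {ι : Type*} [Fintype ι] [DecidableEq ι]
    {B D : Matrix ι ι ℝ} (hB : IsUnit B) (h : ∀ w, ∃ t : ℝ, D *ᵥ w = t • (B *ᵥ w)) :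
    ∃ a : ℝ, D = a • B := by
  have hdet := (isUnit_iff_isUnit_det B).1 hB
  obtain ⟨a, ha⟩ := LinearMap.exists_eq_smul_id_of_forall_notLinearIndependent
    (f := toLin' (D * B⁻¹)) fun v hv => by
      obtain ⟨t, ht⟩ := h (B⁻¹ *ᵥ v)
      rw [mulVec_mulVec, mulVec_mulVec, mul_nonsing_inv _ hdet, one_mulVec] at ht
      have := LinearIndependent.pair_iff.1 hv t (-1) (by simp [ht])
      simp at this
  refine ⟨a, ?_⟩
  have hDB : D * B⁻¹ = a • (1 : Matrix ι ι ℝ) := by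
    apply toLin'.injective
    rw [ha, map_smul, toLin'_one]
    rfl
  rw [← nonsing_inv_mul_cancel_right B D hdet, hDB, smul_mul, one_mul]

/-- If `B` is real antisymmetric and `|w₁ᵀ B w₂| ≥ |w₁ᵀ Δ w₂|` for all real vectors
`w₁, w₂`, then `B = c Δ` for some real `c` with `|c| ≥ 1`. -/
theorem stmt13 (n : ℕ) (hn : 0 < n) (B : Matrix (Fin (2*n)) (Fin (2*n)) ℝ)
    (hB : Bᵀ = -B)
    (h : ∀ w₁ w₂ : Fin (2*n) → ℝ, |w₁ ⬝ᵥ (B *ᵥ w₂)| ≥ |w₁ ⬝ᵥ ((SympForm n) *ᵥ w₂)|) :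
    ∃ c : ℝ, 1 ≤ |c| ∧ B = c • SympForm n := by
  have hzero : ∀ w₁ w₂, w₁ ⬝ᵥ (B *ᵥ w₂) = 0 → w₁ ⬝ᵥ (SympForm n *ᵥ w₂) = 0 := by
    intro w₁ w₂ hw
    have := h w₁ w₂
    rw [hw, abs_zero] at this
    exact abs_nonpos_iff.1 this
  have hpar : ∀ w, ∃ t : ℝ, SympForm n *ᵥ w = t • (B *ᵥ w) := fun w =>
    exists_eq_smul_of_forall_dotProduct_eq_zero fun u => hzero u w
  have hunit : IsUnit B := by
    rw [← mulVec_injective_iff_isUnit]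
    refine (injective_iff_map_eq_zero B.mulVecLin).2 fun w hw => ?_
    obtain ⟨t, ht⟩ := hpar w
    rw [mulVecLin_apply] at hw
    exact SympForm_mulVec_eq_zero (by rw [ht, hw, smul_zero])
  obtain ⟨a, ha⟩ := exists_eq_smul_of_forall_mulVec hunit hpar
  let i : Fin (2*n) := ⟨0, by omega⟩
  let j : Fin (2*n) := ⟨1, by omega⟩
  have hij : SympForm n i j = 1 := by simp [SympForm, i, j]
  have hprod : a * B i j = 1 := by rw [← hij, ha, Matrix.smul_apply, smul_eq_mul]
  have hle : 1 ≤ |B i j| := by simpa [hij] using h (Pi.single i 1) (Pi.single j 1)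
  refine ⟨B i j, hle, ?_⟩
  rw [ha, smul_smul, mul_comm (B i j), hprod, one_smul]
end

section
/- Let τ be a real number with −1 < τ < 1. Then, as the real variable q tends to 0, the complex-valued function f(q) = (1 − τ·e^{iq})/(e^{iq} − τ) · e^{i(1+τ)q/(1−τ)} satisfies f(q) = 1 + i·q³·τ·(1+τ)/(3·(1−τ)³) + O(q⁵); that is, the function q ↦ f(q) − 1 − i·q³·τ·(1+τ)/(3·(1−τ)³) is O(q⁵) as q → 0. -/
open Complex Filter Asymptotics

/-- The fourth Taylor polynomial of `exp` along the imaginary line has an `O(q⁵)` remainder. -/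
theorem exp_imaginary_sub_taylor_isBigO (a : ℝ) :
    (fun q : ℝ => exp (a * (I * q)) -
      (1 + a * (I * q) + (a * (I * q)) ^ 2 / 2 + (a * (I * q)) ^ 3 / 6 + (a * (I * q)) ^ 4 / 24))
      =O[nhds 0] (fun q : ℝ => q ^ 5) := by
  have ht : Tendsto (fun q : ℝ => (a : ℂ) * (I * q)) (nhds 0) (nhds 0) := by
    have : Continuous fun q : ℝ => (a : ℂ) * (I * q) := by fun_prop
    simpa using this.tendsto 0
  have h := (exp_sub_sum_range_isBigO_pow 5).comp_tendsto ht
  refine (h.congr_left fun q => ?_).trans ?_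
  · simp [Finset.sum_range_succ, Nat.factorial]
  · refine IsBigO.of_bound (|a| ^ 5) (Eventually.of_forall fun q => ?_)
    simp [mul_pow]

/-- The part of degree at least five, divided by `z⁵`, in the difference of the numerators when the
exponentials are replaced by their fourth Taylor polynomials. -/
theorem taylor_numerator_sub_eq (t z : ℂ) (ht : 1 - t ≠ 0) :
    (1 - t * (1 + z + z ^ 2 / 2 + z ^ 3 / 6 + z ^ 4 / 24)) *
        (1 + (1 + t) / (1 - t) * z + ((1 + t) / (1 - t) * z) ^ 2 / 2 +
          ((1 + t) / (1 - t) * z) ^ 3 / 6 + ((1 + t) / (1 - t) * z) ^ 4 / 24) -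
      (1 - z ^ 3 * t * (1 + t) / (3 * (1 - t) ^ 3)) *
        (1 + z + z ^ 2 / 2 + z ^ 3 / 6 + z ^ 4 / 24 - t) =
    z ^ 5 * (t * (1 + t) / (3 * (1 - t) ^ 3) * (1 / 2 + z / 6 + z ^ 2 / 24) -
      t * (((1 + t) / (1 - t)) / 24 + ((1 + t) / (1 - t)) ^ 2 / 12 +
        ((1 + t) / (1 - t)) ^ 3 / 12 + ((1 + t) / (1 - t)) ^ 4 / 24 +
        z * (((1 + t) / (1 - t)) ^ 2 / 48 + ((1 + t) / (1 - t)) ^ 3 / 36 +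
          ((1 + t) / (1 - t)) ^ 4 / 48) +
        z ^ 2 * (((1 + t) / (1 - t)) ^ 3 / 144 + ((1 + t) / (1 - t)) ^ 4 / 144) +
        z ^ 3 * (((1 + t) / (1 - t)) ^ 4 / 576))) := by
  field_simp
  ring

/-- For `-1 < τ < 1`, the function
`f(q) = (1 - τ e^{iq})/(e^{iq} - τ) · e^{i(1+τ)q/(1-τ)}` satisfies
`f(q) = 1 + i q³ τ(1+τ)/(3(1-τ)³) + O(q⁵)` as the real variable `q → 0`. -/
theorem stmt19 (τ : ℝ) (h1 : -1 < τ) (h2 : τ < 1) :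
    (fun q : ℝ =>
        ((1 : ℂ) - (τ : ℂ) * Complex.exp (Complex.I * (q : ℂ))) /
            (Complex.exp (Complex.I * (q : ℂ)) - (τ : ℂ)) *
            Complex.exp (Complex.I * (((1 + τ) / (1 - τ) : ℝ) : ℂ) * (q : ℂ)) -
          1 - Complex.I * (q : ℂ) ^ 3 * (τ : ℂ) * ((1 : ℂ) + (τ : ℂ)) /
            (3 * ((1 : ℂ) - (τ : ℂ)) ^ 3)) =O[nhds (0 : ℝ)]
      (fun q : ℝ => q ^ 5) := by
  have ht : (1 : ℂ) - τ ≠ 0 := by exact_mod_cast (sub_pos.2 h2).ne'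
  have bounded {g : ℝ → ℂ} (hg : ContinuousAt g 0) : g =O[nhds 0] (fun _ => (1 : ℝ)) :=
    hg.isBigO_one ℝ
  have hE : (fun q : ℝ => exp (I * q) -
      (1 + I * q + (I * q) ^ 2 / 2 + (I * q) ^ 3 / 6 + (I * q) ^ 4 / 24))
      =O[nhds 0] (fun q : ℝ => q ^ 5) := by
    simpa using exp_imaginary_sub_taylor_isBigO 1
  have hA := exp_imaginary_sub_taylor_isBigO ((1 + τ) / (1 - τ))
  have hz : (fun q : ℝ => (I * q) ^ 5) =O[nhds 0] (fun q : ℝ => q ^ 5) :=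
    IsBigO.of_bound 1 (Eventually.of_forall fun q => by simp)
  have hden : ContinuousAt (fun q : ℝ => exp (I * q) - (τ : ℂ)) 0 := by fun_prop
  have hne : ∀ᶠ q : ℝ in nhds 0, exp (I * q) - (τ : ℂ) ≠ 0 :=
    hden.eventually_ne (by simpa using ht)
  have hinv : (fun q : ℝ => (exp (I * q) - (τ : ℂ))⁻¹) =O[nhds 0] (fun _ => (1 : ℝ)) :=
    bounded (hden.inv₀ (by simpa using ht))
  have hpoly := hz.mul (bounded (g := fun q : ℝ =>
    (τ : ℂ) * (1 + τ) / (3 * (1 - τ) ^ 3) * (1 / 2 + (I * q) / 6 + (I * q) ^ 2 / 24) -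
      τ * (((1 + τ) / (1 - τ)) / 24 + ((1 + τ) / (1 - τ)) ^ 2 / 12 +
        ((1 + τ) / (1 - τ)) ^ 3 / 12 + ((1 + τ) / (1 - τ)) ^ 4 / 24 +
        (I * q) * (((1 + τ) / (1 - τ)) ^ 2 / 48 + ((1 + τ) / (1 - τ)) ^ 3 / 36 +
          ((1 + τ) / (1 - τ)) ^ 4 / 48) +
        (I * q) ^ 2 * (((1 + τ) / (1 - τ)) ^ 3 / 144 + ((1 + τ) / (1 - τ)) ^ 4 / 144) +
        (I * q) ^ 3 * (((1 + τ) / (1 - τ)) ^ 4 / 576))) (by fun_prop))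
  have hEA := hE.mul (bounded (g := fun q : ℝ =>
    -(τ : ℂ) * exp (((1 + τ) / (1 - τ) : ℝ) * (I * q)) -
      (1 - (I * q) ^ 3 * τ * (1 + τ) / (3 * (1 - τ) ^ 3))) (by fun_prop))
  have hAT := hA.mul (bounded (g := fun q : ℝ =>
    1 - (τ : ℂ) * (1 + I * q + (I * q) ^ 2 / 2 + (I * q) ^ 3 / 6 + (I * q) ^ 4 / 24))
    (by fun_prop))
  refine ((hpoly.add (hEA.add hAT)).mul hinv).congr' ?_
    (Eventually.of_forall fun q => by simp)
  filter_upwards [hne] with q hq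
  have hexp : I * (((1 + τ) / (1 - τ) : ℝ) : ℂ) * (q : ℂ) =
      ((1 + τ) / (1 - τ) : ℝ) * (I * q) := by ring
  have hcube : I * (q : ℂ) ^ 3 = -(I * q) ^ 3 := by
    rw [mul_pow, I_pow_three]
    ring
  have hquot (x y c : ℂ) : x / (exp (I * q) - τ) * y - 1 - c =
      (x * y - (1 + c) * (exp (I * q) - τ)) / (exp (I * q) - τ) := by
    field_simp
    ring
  rw [← taylor_numerator_sub_eq (τ : ℂ) (I * q) ht, hexp, hcube, hquot, ← div_eq_mul_inv,
    div_left_inj' hq]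
  push_cast
  ring
end
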